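/- arXiv:1606.06199 — 4 statements merged into one kernel-verified Lean document; each statement's English description precedes it below -/
import Mathlib

section
/- Let u, v : ℝ³ → ℝ³ be continuously differentiable, compactly supported vector fields with div u = 0 and div v = 0 everywhere, and let m : ℝ³ → ℝ³ be a continuously differentiable vector field. Then ∫_{ℝ³} m · [u, v] dx = ∫_{ℝ³} (u × curl m) · v dx = − ∫_{ℝ³} (grad(u·m) + (curl m) × u) · v dx. In particular, the pairing of m with the Jacobi–Lie bracket [u,v] equals minus the pairing of the Lie derivative L_u m = grad(u·m) + (curl m) × u with v. -/
open MeasureTheory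

/-- Partial derivative `∂_j f` of a scalar function on `ℝ³` in the `j`-th coordinate
direction, evaluated at `x`. -/
noncomputable def pd3 (j : Fin 3) (f : (Fin 3 → ℝ) → ℝ) (x : Fin 3 → ℝ) : ℝ :=
  fderiv ℝ f x (Pi.single j 1)

/-- Euclidean inner product on `ℝ³`. -/
def dot3 (u w : Fin 3 → ℝ) : ℝ := ∑ i : Fin 3, u i * w i

/-- Cross product on `ℝ³`. -/
def cross3 (u w : Fin 3 → ℝ) : Fin 3 → ℝ :=
  ![u 1 * w 2 - u 2 * w 1, u 2 * w 0 - u 0 * w 2, u 0 * w 1 - u 1 * w 0]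

/-- Curl of a vector field on `ℝ³`. -/
noncomputable def curl3 (a : (Fin 3 → ℝ) → (Fin 3 → ℝ)) (x : Fin 3 → ℝ) : Fin 3 → ℝ :=
  ![pd3 1 (fun y => a y 2) x - pd3 2 (fun y => a y 1) x,
    pd3 2 (fun y => a y 0) x - pd3 0 (fun y => a y 2) x,
    pd3 0 (fun y => a y 1) x - pd3 1 (fun y => a y 0) x]

/-- Jacobi–Lie bracket of two vector fields on `ℝ³`:
`[u,v]_i = Σ_j (u_j ∂_j v_i − v_j ∂_j u_i)`. -/
noncomputable def bracket3 (u v : (Fin 3 → ℝ) → (Fin 3 → ℝ)) (x : Fin 3 → ℝ) :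
    Fin 3 → ℝ :=
  fun i => ∑ j : Fin 3,
    (u x j * pd3 j (fun y => v y i) x - v x j * pd3 j (fun y => u y i) x)

/-- Lie derivative of the one-form `m` (identified with a vector field) along `u`:
`L_u m = grad (u·m) + (curl m) × u`. -/
noncomputable def lieDeriv3 (u m : (Fin 3 → ℝ) → (Fin 3 → ℝ)) (x : Fin 3 → ℝ) :
    Fin 3 → ℝ :=
  fun i => pd3 i (fun y => dot3 (u y) (m y)) x + cross3 (curl3 m x) (u x) i

theorem pd3_mul (j : Fin 3) {f g : (Fin 3 → ℝ) → ℝ} {x : Fin 3 → ℝ}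
    (hf : DifferentiableAt ℝ f x) (hg : DifferentiableAt ℝ g x) :
    pd3 j (fun y => f y * g y) x = pd3 j f x * g x + f x * pd3 j g x := by
  simp only [pd3, fderiv_fun_mul hf hg, add_apply,
    smul_apply, smul_eq_mul]
  ring

theorem pd3_sub (j : Fin 3) {f g : (Fin 3 → ℝ) → ℝ} {x : Fin 3 → ℝ}
    (hf : DifferentiableAt ℝ f x) (hg : DifferentiableAt ℝ g x) :
    pd3 j (fun y => f y - g y) x = pd3 j f x - pd3 j g x := by
  simp only [pd3, fderiv_fun_sub hf hg, sub_apply]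

theorem pd3_dot3 (j : Fin 3) {a b : (Fin 3 → ℝ) → (Fin 3 → ℝ)} {x : Fin 3 → ℝ}
    (ha : ∀ i, DifferentiableAt ℝ (fun y => a y i) x)
    (hb : ∀ i, DifferentiableAt ℝ (fun y => b y i) x) :
    pd3 j (fun y => dot3 (a y) (b y)) x =
      ∑ i, (pd3 j (fun y => a y i) x * b x i + a x i * pd3 j (fun y => b y i) x) := by
  simp only [← pd3_mul j (ha _) (hb _)]
  simp only [pd3, dot3]
  rw [fderiv_fun_sum fun i _ => (ha i).fun_mul (hb i)]
  simp

theorem continuous_pd3 (j : Fin 3) {f : (Fin 3 → ℝ) → ℝ} (hf : ContDiff ℝ 1 f) :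
    Continuous (pd3 j f) :=
  (hf.continuous_fderiv one_ne_zero).clm_apply continuous_const

theorem integrable_pd3 (j : Fin 3) {f : (Fin 3 → ℝ) → ℝ} (hf : ContDiff ℝ 1 f)
    (hcf : HasCompactSupport f) : Integrable (pd3 j f) :=
  (continuous_pd3 j hf).integrable_of_hasCompactSupport (hcf.fderiv_apply ℝ _)

theorem integral_pd3_eq_zero (j : Fin 3) {f : (Fin 3 → ℝ) → ℝ} (hf : ContDiff ℝ 1 f)
    (hcf : HasCompactSupport f) : ∫ x, pd3 j f x = 0 := by
  have h := integral_smul_fderiv_eq_neg_fderiv_smul_of_integrable (𝕜 := ℝ)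
    (μ := (volume : Measure (Fin 3 → ℝ))) (f := fun _ => (1 : ℝ)) (g := f)
    (v := Pi.single j 1) (by simp) (by simpa using! integrable_pd3 j hf hcf)
    (by simpa using hf.continuous.integrable_of_hasCompactSupport hcf)
    (by fun_prop) fun x _ => hf.differentiable one_ne_zero x
  simpa [pd3] using h

/-- Integrands that differ by the divergence of a compactly supported `C¹` field have the same
integral. -/
theorem integral_eq_of_eq_add_div {F G : (Fin 3 → ℝ) → ℝ} {W : (Fin 3 → ℝ) → (Fin 3 → ℝ)}
    (hW : ∀ j, ContDiff ℝ 1 fun y => W y j) (hcW : ∀ j, HasCompactSupport fun y => W y j)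
    (hG : Integrable G) (hFG : ∀ x, F x = G x + ∑ j, pd3 j (fun y => W y j) x) :
    ∫ x, F x = ∫ x, G x := by
  have hI : ∀ j, Integrable (pd3 j fun y => W y j) := fun j => integrable_pd3 j (hW j) (hcW j)
  simp_rw [hFG]
  rw [integral_add hG (integrable_finsetSum _ fun j _ => hI j),
    integral_finsetSum _ fun j _ => hI j]
  simp [integral_pd3_eq_zero _ (hW _) (hcW _)]

/-- For compactly supported, divergence-free `C¹` vector fields `u, v` and a `C¹`
vector field `m` on `ℝ³`:
`∫ m·[u,v] = ∫ (u × curl m)·v = −∫ (grad(u·m) + (curl m) × u)·v`. -/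
theorem integral_momentum_bracket_eq_neg_integral_lieDeriv_3d
    (u v m : (Fin 3 → ℝ) → (Fin 3 → ℝ))
    (hu : ContDiff ℝ 1 u) (hv : ContDiff ℝ 1 v) (hm : ContDiff ℝ 1 m)
    (hcu : HasCompactSupport u) (hcv : HasCompactSupport v)
    (hdivu : ∀ x : Fin 3 → ℝ, (∑ i : Fin 3, pd3 i (fun y => u y i) x) = 0)
    (hdivv : ∀ x : Fin 3 → ℝ, (∑ i : Fin 3, pd3 i (fun y => v y i) x) = 0) :
    (∫ x : Fin 3 → ℝ, dot3 (m x) (bracket3 u v x))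
        = (∫ x : Fin 3 → ℝ, dot3 (cross3 (u x) (curl3 m x)) (v x))
      ∧ (∫ x : Fin 3 → ℝ, dot3 (m x) (bracket3 u v x))
        = - ∫ x : Fin 3 → ℝ, dot3 (lieDeriv3 u m x) (v x) := by
  have hu' : ∀ i, ContDiff ℝ 1 fun y => u y i := contDiff_pi.1 hu
  have hv' : ∀ i, ContDiff ℝ 1 fun y => v y i := contDiff_pi.1 hv
  have hm' : ∀ i, ContDiff ℝ 1 fun y => m y i := contDiff_pi.1 hm
  have hcu' : ∀ i, HasCompactSupport fun y => u y i := fun i =>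
    hcu.comp_left (g := fun w : Fin 3 → ℝ => w i) rfl
  have hcv' : ∀ i, HasCompactSupport fun y => v y i := fun i =>
    hcv.comp_left (g := fun w : Fin 3 → ℝ => w i) rfl
  have du : ∀ x i, DifferentiableAt ℝ (fun y => u y i) x := fun x i =>
    (hu' i).differentiable one_ne_zero x
  have dv : ∀ x i, DifferentiableAt ℝ (fun y => v y i) x := fun x i =>
    (hv' i).differentiable one_ne_zero x
  have dm : ∀ x i, DifferentiableAt ℝ (fun y => m y i) x := fun x i =>
    (hm' i).differentiable one_ne_zero x
  have dot_contDiff : ∀ a b : (Fin 3 → ℝ) → (Fin 3 → ℝ), (∀ i, ContDiff ℝ 1 fun y => a y i) →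
      (∀ i, ContDiff ℝ 1 fun y => b y i) → ContDiff ℝ 1 fun y => dot3 (a y) (b y) :=
    fun a b ha hb => ContDiff.sum fun i _ => (ha i).mul (hb i)
  have hmv := dot_contDiff m v hm' hv'
  have hum := dot_contDiff u m hu' hm'
  have dmv := hmv.differentiable one_ne_zero
  have dum := hum.differentiable one_ne_zero
  have hG : Integrable fun x => dot3 (cross3 (u x) (curl3 m x)) (v x) := by
    have hcont : Continuous fun x => dot3 (cross3 (u x) (curl3 m x)) (v x) := by
      have := fun i => (hu' i).continuous
      have := fun i => (hv' i).continuous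
      have := fun i j => continuous_pd3 j (hm' i)
      simp only [dot3, cross3, curl3, Fin.sum_univ_three, Matrix.cons_val]
      fun_prop
    refine hcont.integrable_of_hasCompactSupport (hcv.mono fun x hx hvx => hx ?_)
    simp [dot3, hvx]
  have bracket_eq : (∫ x : Fin 3 → ℝ, dot3 (m x) (bracket3 u v x))
      = ∫ x : Fin 3 → ℝ, dot3 (cross3 (u x) (curl3 m x)) (v x) := by
    refine integral_eq_of_eq_add_div
      (W := fun y j => dot3 (m y) (v y) * u y j - dot3 (u y) (m y) * v y j)
      (fun j => (hmv.mul (hu' j)).sub (hum.mul (hv' j)))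
      (fun j => (hcu' j).mul_left.sub (hcv' j).mul_left) hG fun x => ?_
    have h1 := hdivu x
    have h2 := hdivv x
    simp only [pd3_sub _ ((dmv x).fun_mul (du x _)) ((dum x).fun_mul (dv x _)),
      pd3_mul _ (dmv x) (du x _), pd3_mul _ (dum x) (dv x _), pd3_dot3 _ (dm x) (dv x),
      pd3_dot3 _ (du x) (dm x)]
    simp only [dot3, cross3, curl3, bracket3, Fin.sum_univ_three, Matrix.cons_val] at h1 h2 ⊢
    linear_combination
      -(m x 0 * v x 0 + m x 1 * v x 1 + m x 2 * v x 2) * h1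
        + (u x 0 * m x 0 + u x 1 * m x 1 + u x 2 * m x 2) * h2
  refine ⟨bracket_eq, bracket_eq.trans ?_⟩
  rw [← integral_neg]
  refine (integral_eq_of_eq_add_div (W := fun y j => -dot3 (u y) (m y) * v y j)
    (fun j => hum.neg.mul (hv' j)) (fun j => (hcv' j).mul_left) hG fun x => ?_).symm
  have h2 := hdivv x
  have hneg : ∀ j, pd3 j (fun y => -dot3 (u y) (m y)) x = -pd3 j (fun y => dot3 (u y) (m y)) x :=
    fun j => by simp only [pd3, fderiv_fun_neg, neg_apply]
  simp only [pd3_mul _ (dum x).fun_neg (dv x _), hneg]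
  simp only [lieDeriv3, cross3, curl3, dot3, Fin.sum_univ_three, Matrix.cons_val] at h2 ⊢
  linear_combination (u x 0 * m x 0 + u x 1 * m x 1 + u x 2 * m x 2) * h2
end

section
/- Let T > 0, C > 0, h > 0, and let s, n be real numbers. Let q : [0, T] → ℝ be continuous with q(t) ≥ 0 and q(t) ≤ C h^{2s} + C h^{−1−n/2} ∫₀^t e^{τ/2} q(τ)^{3/2} dτ for all t ∈ [0, T]. If h^{s−1−n/2} < 1 / (2 C^{3/2} (e^{T/2} − 1)), then q(T) ≤ h^{2s} (C^{−1/2} − 2 C h^{s−1−n/2} (e^{T/2} − 1))^{−2}. -/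
open Real

open Set in
/-- The primitive of a function continuous on `[0, T]` is differentiable on `(0, T)`. -/
theorem hasDerivAt_integral_of_continuousOn_Icc {T t : ℝ} {f : ℝ → ℝ}
    (hf : ContinuousOn f (Icc 0 T)) (ht : t ∈ Ioo 0 T) :
    HasDerivAt (fun u ↦ ∫ τ in (0 : ℝ)..u, f τ) (f t) t := by
  refine intervalIntegral.integral_hasDerivAt_right ?_ ?_ ?_
  · refine ContinuousOn.intervalIntegrable (hf.mono ?_)
    rw [uIcc_of_le ht.1.le]
    exact Icc_subset_Icc_right ht.2.le
  · exact (hf.mono Ioo_subset_Icc_self).stronglyMeasurableAtFilter isOpen_Ioo t ht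
  · exact hf.continuousAt (Icc_mem_nhds ht.1 ht.2)

open Set in
theorem continuousOn_integral_of_continuousOn_Icc {T : ℝ} (hT : 0 ≤ T) {f : ℝ → ℝ}
    (hf : ContinuousOn f (Icc 0 T)) :
    ContinuousOn (fun u ↦ ∫ τ in (0 : ℝ)..u, f τ) (Icc 0 T) := by
  have h := intervalIntegral.continuousOn_primitive_interval (μ := MeasureTheory.volume)
    (f := f) (a := 0) (b := T) (by rw [uIcc_of_le hT]; exact hf.integrableOn_Icc)
  rwa [uIcc_of_le hT] at h

open Set in
/-- Bihari's inequality for the nonlinearity `x ↦ x ^ (3 / 2)`. -/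
theorem bihari_rpow_three_halves {T a : ℝ} (hT : 0 ≤ T) (ha : 0 < a) {k q : ℝ → ℝ}
    (hk : ContinuousOn k (Icc 0 T)) (hk0 : ∀ t ∈ Icc 0 T, 0 ≤ k t)
    (hq : ContinuousOn q (Icc 0 T)) (hq0 : ∀ t ∈ Icc 0 T, 0 ≤ q t)
    (hle : ∀ t ∈ Icc 0 T, q t ≤ a + ∫ τ in (0 : ℝ)..t, k τ * q τ ^ ((3 : ℝ) / 2)) :
    a ^ (-(1 : ℝ) / 2) - (∫ τ in (0 : ℝ)..T, k τ) / 2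
      ≤ (a + ∫ τ in (0 : ℝ)..T, k τ * q τ ^ ((3 : ℝ) / 2)) ^ (-(1 : ℝ) / 2) := by
  have hf : ContinuousOn (fun τ ↦ k τ * q τ ^ ((3 : ℝ) / 2)) (Icc 0 T) :=
    hk.mul (hq.rpow_const fun _ _ ↦ Or.inr (by norm_num))
  set U : ℝ → ℝ := fun t ↦ a + ∫ τ in (0 : ℝ)..t, k τ * q τ ^ ((3 : ℝ) / 2) with hU
  have hU_pos : ∀ t ∈ Icc 0 T, 0 < U t := fun t ht ↦
    add_pos_of_pos_of_nonneg ha <| intervalIntegral.integral_nonneg ht.1 fun τ hτ ↦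
      have hτ' : τ ∈ Icc 0 T := ⟨hτ.1, hτ.2.trans ht.2⟩
      mul_nonneg (hk0 τ hτ') (rpow_nonneg (hq0 τ hτ') _)
  have hU_cont : ContinuousOn U (Icc 0 T) :=
    continuousOn_const.add (continuousOn_integral_of_continuousOn_Icc hT hf)
  have hmono : MonotoneOn (fun t ↦ U t ^ (-(1 : ℝ) / 2) + (∫ τ in (0 : ℝ)..t, k τ) / 2)
      (Icc 0 T) := by
    refine monotoneOn_of_hasDerivWithinAt_nonneg (convex_Icc 0 T)
      (f' := fun t ↦ k t * q t ^ ((3 : ℝ) / 2) * (-(1 : ℝ) / 2) * U t ^ (-(1 : ℝ) / 2 - 1)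
        + k t / 2) ?_ ?_ ?_
    · exact (hU_cont.rpow_const fun t ht ↦ Or.inl (hU_pos t ht).ne').add
        ((continuousOn_integral_of_continuousOn_Icc hT hk).div_const 2)
    · intro t ht
      rw [interior_Icc] at ht
      have hUt : HasDerivAt U (k t * q t ^ ((3 : ℝ) / 2)) t :=
        (hasDerivAt_integral_of_continuousOn_Icc hf ht).const_add a
      exact ((hUt.rpow_const (Or.inl (hU_pos t (Ioo_subset_Icc_self ht)).ne')).add
        ((hasDerivAt_integral_of_continuousOn_Icc hk ht).div_const 2)).hasDerivWithinAt
    · intro t ht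
      replace ht := interior_subset ht
      have hle' : q t ^ ((3 : ℝ) / 2) * U t ^ (-(1 : ℝ) / 2 - 1) ≤ 1 := by
        calc q t ^ ((3 : ℝ) / 2) * U t ^ (-(1 : ℝ) / 2 - 1)
            ≤ U t ^ ((3 : ℝ) / 2) * U t ^ (-(1 : ℝ) / 2 - 1) := by
              refine mul_le_mul_of_nonneg_right ?_ (rpow_nonneg (hU_pos t ht).le _)
              exact rpow_le_rpow (hq0 t ht) (hle t ht) (by norm_num)
          _ = 1 := by
              rw [← rpow_add (hU_pos t ht)]
              norm_num
      have := mul_le_mul_of_nonneg_left hle' (hk0 t ht)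
      linarith
  have h := hmono (left_mem_Icc.2 hT) (right_mem_Icc.2 hT) hT
  simp only [hU, intervalIntegral.integral_same, add_zero, zero_div] at h
  linarith

/-- Nonlinear (Bihari-type) Gronwall inequality used in the convergence proof of
the upwind scheme: if a nonnegative continuous `q` on `[0, T]` satisfies
`q(t) ≤ C h^{2s} + C h^{−1−n/2} ∫₀ᵗ e^{τ/2} q(τ)^{3/2} dτ` and
`h^{s−1−n/2} < 1 / (2 C^{3/2} (e^{T/2} − 1))`, then
`q(T) ≤ h^{2s} (C^{−1/2} − 2 C h^{s−1−n/2} (e^{T/2} − 1))^{−2}`. -/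
theorem nonlinear_gronwall_upwind
    (T C h s n : ℝ) (hT : 0 < T) (hC : 0 < C) (hh : 0 < h)
    (q : ℝ → ℝ)
    (hq : ContinuousOn q (Set.Icc (0 : ℝ) T))
    (hq0 : ∀ t ∈ Set.Icc (0 : ℝ) T, 0 ≤ q t)
    (hineq : ∀ t ∈ Set.Icc (0 : ℝ) T,
      q t ≤ C * h ^ (2 * s)
        + C * h ^ (-1 - n / 2)
            * ∫ τ in (0 : ℝ)..t, exp (τ / 2) * q τ ^ ((3 : ℝ) / 2))
    (hsmall : h ^ (s - 1 - n / 2)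
        < 1 / (2 * C ^ ((3 : ℝ) / 2) * (exp (T / 2) - 1))) :
    q T ≤ h ^ (2 * s)
      * ((C ^ (-(1 : ℝ) / 2)
          - 2 * C * h ^ (s - 1 - n / 2) * (exp (T / 2) - 1))⁻¹) ^ 2 := by
  set E := exp (T / 2) - 1 with hE
  set r := h ^ (s - 1 - n / 2) with hr
  have hE_pos : 0 < E := sub_pos.2 (one_lt_exp_iff.2 (by positivity))
  have hr_pos : 0 < r := rpow_pos_of_pos hh _
  have hT_mem : T ∈ Set.Icc 0 T := ⟨hT.le, le_rfl⟩
  have hmul : ∀ t, C * h ^ (-1 - n / 2) * ∫ τ in (0 : ℝ)..t, exp (τ / 2) * q τ ^ ((3 : ℝ) / 2)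
      = ∫ τ in (0 : ℝ)..t, C * h ^ (-1 - n / 2) * exp (τ / 2) * q τ ^ ((3 : ℝ) / 2) := by
    intro t
    simp only [mul_assoc, intervalIntegral.integral_const_mul]
  simp only [hmul] at hineq
  have hint : ∫ τ in (0 : ℝ)..T, C * h ^ (-1 - n / 2) * exp (τ / 2)
      = C * h ^ (-1 - n / 2) * (2 * E) := by
    rw [intervalIntegral.integral_const_mul, intervalIntegral.integral_comp_div _ two_ne_zero]
    simp [hE]
  have key := bihari_rpow_three_halves hT.le (a := C * h ^ (2 * s)) (by positivity)
    (k := fun τ ↦ C * h ^ (-1 - n / 2) * exp (τ / 2)) (by fun_prop)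
    (fun _ _ ↦ by positivity) hq hq0 hineq
  rw [hint] at key
  have hqT := hineq T hT_mem
  set u := C * h ^ (2 * s)
    + ∫ τ in (0 : ℝ)..T, C * h ^ (-1 - n / 2) * exp (τ / 2) * q τ ^ ((3 : ℝ) / 2) with hu
  have hu_pos : 0 < u := by
    refine add_pos_of_pos_of_nonneg (by positivity) ?_
    refine intervalIntegral.integral_nonneg hT.le fun τ hτ ↦ ?_
    have := rpow_nonneg (hq0 τ hτ) ((3 : ℝ) / 2)
    positivity
  have hC_pow : C ^ (-(1 : ℝ) / 2) * C ^ ((3 : ℝ) / 2) = C := by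
    rw [← rpow_add hC]
    norm_num
  have hden : 0 < C ^ (-(1 : ℝ) / 2) - 2 * C * r * E := by
    rw [lt_div_iff₀ (by positivity)] at hsmall
    have := mul_lt_mul_of_pos_left hsmall (rpow_pos_of_pos hC (-(1 : ℝ) / 2))
    linear_combination this - 2 * r * E * hC_pow
  have hscale : h ^ (-s) * (C ^ (-(1 : ℝ) / 2) - 2 * C * r * E) ≤ u ^ (-(1 : ℝ) / 2) := by
    have h₁ : (C * h ^ (2 * s)) ^ (-(1 : ℝ) / 2) = C ^ (-(1 : ℝ) / 2) * h ^ (-s) := by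
      rw [mul_rpow hC.le (by positivity), ← rpow_mul hh.le]
      ring_nf
    have h₂ : h ^ (-1 - n / 2) = h ^ (-s) * r := by
      rw [hr, ← rpow_add hh]
      ring_nf
    rw [h₁, h₂] at key
    have : 0 ≤ C * (h ^ (-s) * r) * E := by positivity
    linarith
  have hsq : u = ((u ^ (-(1 : ℝ) / 2))⁻¹) ^ 2 := by
    rw [← rpow_neg hu_pos.le, ← rpow_mul_natCast hu_pos.le]
    norm_num
  calc q T ≤ u := hqT
    _ = ((u ^ (-(1 : ℝ) / 2))⁻¹) ^ 2 := hsq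
    _ ≤ ((h ^ (-s) * (C ^ (-(1 : ℝ) / 2) - 2 * C * r * E))⁻¹) ^ 2 := by
      have : 0 < h ^ (-s) := by positivity
      gcongr
    _ = h ^ (2 * s) * ((C ^ (-(1 : ℝ) / 2) - 2 * C * r * E)⁻¹) ^ 2 := by
      rw [mul_inv, mul_pow, ← rpow_neg hh.le, ← rpow_mul_natCast hh.le]
      push_cast
      ring_nf
end

section
/- Let T > 0, C > 0, h > 0, and let s, n be real numbers. Let q : [0, T] → ℝ be continuous with q(t) ≥ 0 and q(t) ≤ C h^{2s} + C h^{−1−n/2} ∫₀^t e^{τ/2} q(τ)^{3/2} dτ for all t ∈ [0, T]. If h^{s−1−n/2} < 1 / (4 C^{3/2} (e^{T/2} − 1)), then q(T) ≤ 4 C h^{2s}. -/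
open Real

/-- Nonlinear Gronwall inequality with exponent `3/2` and weight `e^{t/2}`: the majorant
`z = A + B ∫₀ᵀ e^{τ/2} q^{3/2}` satisfies `A^{-1/2} ≤ z^{-1/2} + B (e^{T/2} - 1)`. -/
theorem rpow_neg_half_le_of_le_integral {T A B : ℝ} (hT : 0 ≤ T) (hA : 0 < A) (hB : 0 ≤ B)
    {q : ℝ → ℝ} (hq : ContinuousOn q (Set.Icc 0 T)) (hq0 : ∀ t ∈ Set.Icc 0 T, 0 ≤ q t)
    (hineq : ∀ t ∈ Set.Icc 0 T,
      q t ≤ A + B * ∫ τ in (0 : ℝ)..t, exp (τ / 2) * q τ ^ ((3 : ℝ) / 2)) :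
    A ^ (-(1 / 2) : ℝ) ≤
      (A + B * ∫ τ in (0 : ℝ)..T, exp (τ / 2) * q τ ^ ((3 : ℝ) / 2)) ^ (-(1 / 2) : ℝ)
        + B * (exp (T / 2) - 1) := by
  set g : ℝ → ℝ := fun τ => exp (τ / 2) * q τ ^ ((3 : ℝ) / 2) with hg
  set z : ℝ → ℝ := fun t => A + B * ∫ τ in (0 : ℝ)..t, g τ with hz
  have hgc : ContinuousOn g (Set.Icc 0 T) :=
    (by fun_prop : Continuous fun τ : ℝ => exp (τ / 2)).continuousOn.mul
      (hq.rpow_const fun _ _ => Or.inr (by norm_num))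
  have hzpos : ∀ t ∈ Set.Icc 0 T, 0 < z t := fun t ht => by
    have : 0 ≤ ∫ τ in (0 : ℝ)..t, g τ := intervalIntegral.integral_nonneg ht.1 fun u hu =>
      mul_nonneg (exp_pos _).le (rpow_nonneg (hq0 u ⟨hu.1, hu.2.trans ht.2⟩) _)
    exact add_pos_of_pos_of_nonneg hA (mul_nonneg hB this)
  have hzc : ContinuousOn z (Set.Icc 0 T) := by
    have hint : MeasureTheory.IntegrableOn g (Set.uIcc 0 T) := by
      rw [Set.uIcc_of_le hT]
      exact hgc.integrableOn_Icc
    have := intervalIntegral.continuousOn_primitive_interval hint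
    rw [Set.uIcc_of_le hT] at this
    exact continuousOn_const.add (continuousOn_const.mul this)
  have hzd : ∀ t ∈ Set.Ioo 0 T, HasDerivAt z (B * g t) t := fun t ht => by
    have hint : IntervalIntegrable g MeasureTheory.volume 0 t :=
      (hgc.mono (Set.Icc_subset_Icc_right ht.2.le)).intervalIntegrable_of_Icc ht.1.le
    have hmeas : StronglyMeasurableAtFilter g (nhds t) :=
      (hgc.mono Set.Ioo_subset_Icc_self).stronglyMeasurableAtFilter isOpen_Ioo t ht
    exact ((intervalIntegral.integral_hasDerivAt_right hint hmeas
      (hgc.continuousAt (Icc_mem_nhds ht.1 ht.2))).const_mul B).const_add A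
  have hmono : MonotoneOn (fun t => z t ^ (-(1 / 2) : ℝ) + B * exp (t / 2)) (Set.Icc 0 T) := by
    refine monotoneOn_of_hasDerivWithinAt_nonneg (convex_Icc 0 T)
      (f' := fun t => B * g t * (-(1 / 2)) * z t ^ (-(1 / 2) - 1 : ℝ)
        + B * (exp (t / 2) * (1 / 2))) ?_ ?_ ?_
    · exact (hzc.rpow_const fun t ht => Or.inl (hzpos t ht).ne').add (by fun_prop)
    · intro t ht
      rw [interior_Icc] at ht
      exact (((hzd t ht).rpow_const (Or.inl (hzpos t (Set.Ioo_subset_Icc_self ht)).ne')).add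
        ((((hasDerivAt_id t).div_const 2).exp).const_mul B)).hasDerivWithinAt
    · intro t ht
      have ht' := interior_subset ht
      have hz0 := hzpos t ht'
      have hle : q t ^ ((3 : ℝ) / 2) * z t ^ (-(1 / 2) - 1 : ℝ) ≤ 1 := by
        have h1 : q t ^ ((3 : ℝ) / 2) ≤ z t ^ ((3 : ℝ) / 2) :=
          rpow_le_rpow (hq0 t ht') (hineq t ht') (by norm_num)
        calc q t ^ ((3 : ℝ) / 2) * z t ^ (-(1 / 2) - 1 : ℝ)
            ≤ z t ^ ((3 : ℝ) / 2) * z t ^ (-(1 / 2) - 1 : ℝ) := by gcongr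
          _ = 1 := by rw [← rpow_add hz0]; norm_num
      have := mul_nonneg (mul_nonneg hB (exp_pos (t / 2)).le) (sub_nonneg.2 hle)
      simp only [hg]
      linarith
  have := hmono (Set.left_mem_Icc.2 hT) (Set.right_mem_Icc.2 hT) hT
  simp only [hz, intervalIntegral.integral_same, mul_zero, add_zero, zero_div, exp_zero] at this
  linarith

/-- Final error bound of the upwind convergence proof: if a nonnegative continuous
`q` on `[0, T]` satisfies
`q(t) ≤ C h^{2s} + C h^{−1−n/2} ∫₀ᵗ e^{τ/2} q(τ)^{3/2} dτ` and
`h^{s−1−n/2} < 1 / (4 C^{3/2} (e^{T/2} − 1))`, then `q(T) ≤ 4 C h^{2s}`. -/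
theorem nonlinear_gronwall_upwind_final
    (T C h s n : ℝ) (hT : 0 < T) (hC : 0 < C) (hh : 0 < h)
    (q : ℝ → ℝ)
    (hq : ContinuousOn q (Set.Icc (0 : ℝ) T))
    (hq0 : ∀ t ∈ Set.Icc (0 : ℝ) T, 0 ≤ q t)
    (hineq : ∀ t ∈ Set.Icc (0 : ℝ) T,
      q t ≤ C * h ^ (2 * s)
        + C * h ^ (-1 - n / 2)
            * ∫ τ in (0 : ℝ)..t, exp (τ / 2) * q τ ^ ((3 : ℝ) / 2))
    (hsmall : h ^ (s - 1 - n / 2)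
        < 1 / (4 * C ^ ((3 : ℝ) / 2) * (exp (T / 2) - 1))) :
    q T ≤ 4 * C * h ^ (2 * s) := by
  have hA : 0 < C * h ^ (2 * s) := by positivity
  have hB : 0 < C * h ^ (-1 - n / 2) := by positivity
  have key := rpow_neg_half_le_of_le_integral hT.le hA hB.le hq hq0 hineq
  have hqT := hineq T (Set.right_mem_Icc.2 hT.le)
  set A := C * h ^ (2 * s) with hAdef
  set B := C * h ^ (-1 - n / 2) with hBdef
  set z := A + B * ∫ τ in (0 : ℝ)..T, exp (τ / 2) * q τ ^ ((3 : ℝ) / 2)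
  have hE : 0 < exp (T / 2) - 1 := sub_pos.2 (one_lt_exp_iff.2 (by linarith))
  have hAB : B = C ^ ((3 : ℝ) / 2) * h ^ (s - 1 - n / 2) * A ^ (-(1 / 2) : ℝ) := by
    rw [hAdef, mul_rpow hC.le (rpow_nonneg hh.le _), ← rpow_mul hh.le, mul_mul_mul_comm,
      ← rpow_add hC, ← rpow_add hh, hBdef,
      show (3 : ℝ) / 2 + -(1 / 2) = 1 by norm_num, rpow_one]
    congr 2
    ring
  have hBE : B * (exp (T / 2) - 1) ≤ 1 / 4 * A ^ (-(1 / 2) : ℝ) := by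
    rw [lt_div_iff₀ (by positivity)] at hsmall
    rw [hAB]
    have hA' : 0 < A ^ (-(1 / 2) : ℝ) := by positivity
    nlinarith [mul_lt_mul_of_pos_right hsmall hA']
  have hfour : (4 * A) ^ (-(1 / 2) : ℝ) = 1 / 2 * A ^ (-(1 / 2) : ℝ) := by
    rw [mul_rpow (by norm_num) hA.le, show (4 : ℝ) = 2 ^ (2 : ℝ) by norm_num,
      ← rpow_mul (by norm_num)]
    norm_num [rpow_neg_one]
  have hA' : 0 < A ^ (-(1 / 2) : ℝ) := by positivity
  by_contra! hlt
  have hz : 4 * A < z := by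
    rw [mul_assoc] at hlt
    exact hlt.trans_le hqT
  have := rpow_lt_rpow_of_neg (by positivity) hz (by norm_num : (-(1 / 2) : ℝ) < 0)
  linarith
end

section
/- Let u, v : ℝ² → ℝ² be continuously differentiable, compactly supported vector fields with div u = 0 and div v = 0 everywhere, and let m : ℝ² → ℝ² be a continuously differentiable vector field. Then ∫_{ℝ²} m · [u, v] dx = − ∫_{ℝ²} (grad(u·m) + (rot m) u^⊥) · v dx, where rot m := ∂₁m₂ − ∂₂m₁ and u^⊥ := (−u₂, u₁) is the rotation of u by π/2; that is, the pairing of m with the Jacobi–Lie bracket [u,v] equals minus the pairing of the two-dimensional Lie derivative L_u m = grad(u·m) + (rot m) u^⊥ with v. -/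
open MeasureTheory

/-- Partial derivative `∂_j f` of a scalar function on `ℝ²` in the `j`-th coordinate
direction, evaluated at `x`. -/
noncomputable def pd2 (j : Fin 2) (f : (Fin 2 → ℝ) → ℝ) (x : Fin 2 → ℝ) : ℝ :=
  fderiv ℝ f x (Pi.single j 1)

/-- Euclidean inner product on `ℝ²`. -/
def dot2 (u w : Fin 2 → ℝ) : ℝ := ∑ i : Fin 2, u i * w i

/-- Scalar rotation `rot a = ∂₁a₂ − ∂₂a₁` of a vector field on `ℝ²`
(indices written `0, 1`). -/
noncomputable def rot2 (a : (Fin 2 → ℝ) → (Fin 2 → ℝ)) (x : Fin 2 → ℝ) : ℝ :=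
  pd2 0 (fun y => a y 1) x - pd2 1 (fun y => a y 0) x

/-- Rotation of a vector in `ℝ²` by `π/2`: `u^⊥ = (−u₂, u₁)`. -/
def perp2 (w : Fin 2 → ℝ) : Fin 2 → ℝ := ![-(w 1), w 0]

/-- Jacobi–Lie bracket of two vector fields on `ℝ²`:
`[u,v]_i = Σ_j (u_j ∂_j v_i − v_j ∂_j u_i)`. -/
noncomputable def bracket2 (u v : (Fin 2 → ℝ) → (Fin 2 → ℝ)) (x : Fin 2 → ℝ) :
    Fin 2 → ℝ :=
  fun i => ∑ j : Fin 2,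
    (u x j * pd2 j (fun y => v y i) x - v x j * pd2 j (fun y => u y i) x)

/-- Two-dimensional Lie derivative of the one-form `m` (identified with a vector
field) along `u`: `L_u m = grad (u·m) + (rot m) u^⊥`. -/
noncomputable def lieDeriv2 (u m : (Fin 2 → ℝ) → (Fin 2 → ℝ)) (x : Fin 2 → ℝ) :
    Fin 2 → ℝ :=
  fun i => pd2 i (fun y => dot2 (u y) (m y)) x + rot2 m x * perp2 (u x) i

lemma pd2_mul {f g : (Fin 2 → ℝ) → ℝ} (hf : ContDiff ℝ 1 f) (hg : ContDiff ℝ 1 g)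
    (j : Fin 2) (x : Fin 2 → ℝ) :
    pd2 j (fun y => f y * g y) x = f x * pd2 j g x + g x * pd2 j f x := by
  simp [pd2, fderiv_fun_mul (hf.differentiable one_ne_zero x) (hg.differentiable one_ne_zero x)]

lemma pd2_add {f g : (Fin 2 → ℝ) → ℝ} (hf : ContDiff ℝ 1 f) (hg : ContDiff ℝ 1 g)
    (j : Fin 2) (x : Fin 2 → ℝ) :
    pd2 j (fun y => f y + g y) x = pd2 j f x + pd2 j g x := by
  simp [pd2, fderiv_fun_add (hf.differentiable one_ne_zero x) (hg.differentiable one_ne_zero x)]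

lemma continuous_pd2 {f : (Fin 2 → ℝ) → ℝ} (hf : ContDiff ℝ 1 f) (j : Fin 2) :
    Continuous (pd2 j f) :=
  (hf.continuous_fderiv one_ne_zero).clm_apply continuous_const

lemma integrable_pd2 {f : (Fin 2 → ℝ) → ℝ} (hf : ContDiff ℝ 1 f) (hc : HasCompactSupport f)
    (j : Fin 2) : Integrable (pd2 j f) :=
  (continuous_pd2 hf j).integrable_of_hasCompactSupport (hc.fderiv_apply (𝕜 := ℝ) _)

lemma integral_pd2_eq_zero {f : (Fin 2 → ℝ) → ℝ} (hf : ContDiff ℝ 1 f)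
    (hc : HasCompactSupport f) (j : Fin 2) : ∫ x, pd2 j f x = 0 := by
  have h := integral_mul_fderiv_eq_neg_fderiv_mul_of_integrable (μ := volume) (𝕜 := ℝ)
    (f := fun _ : Fin 2 → ℝ => (1 : ℝ)) (g := f) (v := Pi.single j 1) (by simp)
    (by simp only [one_mul]; exact integrable_pd2 hf hc j)
    (by simpa using hf.continuous.integrable_of_hasCompactSupport hc)
    (fun x _ => differentiableAt_const _) (fun x _ => hf.differentiable one_ne_zero x)
  simpa [pd2] using h

/-- The pairings of `m` with `[u,v]` and of `L_u m` with `v` add up to `div ((m·v) u)`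
when `div u = 0`. -/
lemma dot2_bracket2_add_dot2_lieDeriv2 {u v m : (Fin 2 → ℝ) → (Fin 2 → ℝ)}
    (hu : ContDiff ℝ 1 u) (hv : ContDiff ℝ 1 v) (hm : ContDiff ℝ 1 m) (x : Fin 2 → ℝ)
    (hdivu : (∑ i : Fin 2, pd2 i (fun y => u y i) x) = 0) :
    dot2 (m x) (bracket2 u v x) + dot2 (lieDeriv2 u m x) (v x)
      = ∑ j : Fin 2, pd2 j (fun y => u y j * dot2 (m y) (v y)) x := by
  have hu' := contDiff_pi.1 hu
  have hv' := contDiff_pi.1 hv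
  have hm' := contDiff_pi.1 hm
  have hdot {a b : (Fin 2 → ℝ) → (Fin 2 → ℝ)} (ha : ∀ i, ContDiff ℝ 1 fun y => a y i)
      (hb : ∀ i, ContDiff ℝ 1 fun y => b y i) (j : Fin 2) :
      pd2 j (fun y => a y 0 * b y 0 + a y 1 * b y 1) x
        = a x 0 * pd2 j (fun y => b y 0) x + b x 0 * pd2 j (fun y => a y 0) x
          + (a x 1 * pd2 j (fun y => b y 1) x + b x 1 * pd2 j (fun y => a y 1) x) := by
    rw [pd2_add ((ha 0).mul (hb 0)) ((ha 1).mul (hb 1)), pd2_mul (ha 0) (hb 0),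
      pd2_mul (ha 1) (hb 1)]
  simp only [bracket2, lieDeriv2, dot2, rot2, perp2, Fin.sum_univ_two, Matrix.cons_val_zero,
    Matrix.cons_val_one] at hdivu ⊢
  have hmv := ((hm' 0).mul (hv' 0)).add ((hm' 1).mul (hv' 1))
  rw [pd2_mul (hu' 0) hmv, pd2_mul (hu' 1) hmv]
  simp only [hdot hu' hm', hdot hm' hv']
  linear_combination (-(m x 0 * v x 0 + m x 1 * v x 1)) * hdivu

/-- For compactly supported, divergence-free `C¹` vector fields `u, v` and a `C¹`
vector field `m` on `ℝ²`:
`∫ m·[u,v] = −∫ (grad(u·m) + (rot m) u^⊥)·v`. -/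
theorem integral_momentum_bracket_eq_neg_integral_lieDeriv_2d
    (u v m : (Fin 2 → ℝ) → (Fin 2 → ℝ))
    (hu : ContDiff ℝ 1 u) (hv : ContDiff ℝ 1 v) (hm : ContDiff ℝ 1 m)
    (hcu : HasCompactSupport u) (hcv : HasCompactSupport v)
    (hdivu : ∀ x : Fin 2 → ℝ, (∑ i : Fin 2, pd2 i (fun y => u y i) x) = 0)
    (hdivv : ∀ x : Fin 2 → ℝ, (∑ i : Fin 2, pd2 i (fun y => v y i) x) = 0) :
    (∫ x : Fin 2 → ℝ, dot2 (m x) (bracket2 u v x))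
      = - ∫ x : Fin 2 → ℝ, dot2 (lieDeriv2 u m x) (v x) := by
  have hu' := contDiff_pi.1 hu
  have hv' := contDiff_pi.1 hv
  have hm' := contDiff_pi.1 hm
  have hF (j : Fin 2) : ContDiff ℝ 1 fun y => u y j * dot2 (m y) (v y) :=
    (hu' j).mul (ContDiff.sum fun i _ => (hm' i).mul (hv' i))
  have hcF (j : Fin 2) : HasCompactSupport fun y => u y j * dot2 (m y) (v y) :=
    hcu.mono fun x hx h => hx (by simp [h])
  have hL : Integrable fun x => dot2 (lieDeriv2 u m x) (v x) := by
    refine Continuous.integrable_of_hasCompactSupport ?_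
      (hcv.mono fun x hx h => hx (by simp [h, dot2]))
    have hgrad (i : Fin 2) : Continuous (pd2 i fun y => dot2 (u y) (m y)) :=
      continuous_pd2 (ContDiff.sum fun i _ => (hu' i).mul (hm' i)) i
    have hrot : Continuous (rot2 m) :=
      (continuous_pd2 (hm' 1) 0).sub (continuous_pd2 (hm' 0) 1)
    have hu0 := (hu' 0).continuous
    have hu1 := (hu' 1).continuous
    refine continuous_finsetSum _ fun i _ => ((hgrad i).add (hrot.mul ?_)).mul (hv' i).continuous
    fin_cases i
    · exact hu1.neg
    · exact hu0
  calc ∫ x, dot2 (m x) (bracket2 u v x)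
      = ∫ x, ((∑ j : Fin 2, pd2 j (fun y => u y j * dot2 (m y) (v y)) x)
          - dot2 (lieDeriv2 u m x) (v x)) :=
        integral_congr_ae (.of_forall fun x =>
          eq_sub_of_add_eq (dot2_bracket2_add_dot2_lieDeriv2 hu hv hm x (hdivu x)))
    _ = - ∫ x, dot2 (lieDeriv2 u m x) (v x) := by
        rw [integral_sub (integrable_finsetSum _ fun j _ => integrable_pd2 (hF j) (hcF j) j) hL,
          integral_finsetSum _ fun j _ => integrable_pd2 (hF j) (hcF j) j]
        simp [integral_pd2_eq_zero (hF _) (hcF _)]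
end
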